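/- arXiv:math/0303281 — 2 statements merged into one kernel-verified Lean document; each statement's English description precedes it below -/
import Mathlib

section
/- Let Θ ⊆ I. Every ∼_Θ-equivalence class on W × W contains exactly one pair (w₁, w₂) with w₁ ∈ W^Θ and w₂ ∈ ^{Θ∪Θ^⊥}W (the normal form I representative of the class). -/
open Classical

namespace Paper

variable {B : Type*} {M : CoxeterMatrix B} {W : Type*} [Group W]

/-- `Θ^⊥`: the indices whose simple reflections commute with all simple
reflections indexed by `Θ` (i.e. `m(i,j) = 2` for all `j ∈ Θ`). -/
def perp (M : CoxeterMatrix B) (Θ : Set B) : Set B := {i | i ∉ Θ ∧ ∀ j ∈ Θ, M i j = 2}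

variable (cs : CoxeterSystem M W)

/-- The standard parabolic subgroup `W_J` generated by the simple reflections indexed by `J`. -/
def parabolic (J : Set B) : Subgroup W := Subgroup.closure (cs.simple '' J)

/-- `W^J`: the minimal-length representatives of the cosets `W/W_J`,
`{w : ℓ(wu) = ℓ(w) + ℓ(u) for all u ∈ W_J}`. -/
def minRight (J : Set B) : Set W :=
  {w | ∀ u ∈ parabolic cs J, cs.length (w * u) = cs.length w + cs.length u}

/-- `^JW`: the minimal-length representatives of the cosets `W_J\W`,
`{w : ℓ(uw) = ℓ(u) + ℓ(w) for all u ∈ W_J}`. -/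
def minLeft (J : Set B) : Set W :=
  {w | ∀ u ∈ parabolic cs J, cs.length (u * w) = cs.length u + cs.length w}

/-- The Bruhat order on `W`: `x ≤ y` iff `y` is obtained from `x` by a chain of
right multiplications by reflections, each strictly increasing the length. -/
def bruhatLE : W → W → Prop :=
  Relation.ReflTransGen (fun x y => ∃ t, cs.IsReflection t ∧ y = x * t ∧ cs.length x < cs.length y)

/-- The equivalence relation `∼_Θ` on `W × W`:
`(x,y) ∼_Θ (x',y')` iff there are `u ∈ W_{Θ∪Θ^⊥}` and `v ∈ W_Θ` with `x' = xu`, `y' = u⁻¹vy`. -/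
def simRel (Θ : Set B) (p q : W × W) : Prop :=
  ∃ u ∈ parabolic cs (Θ ∪ perp M Θ), ∃ v ∈ parabolic cs Θ,
    q.1 = p.1 * u ∧ q.2 = u⁻¹ * v * p.2

/-- `w^J`: the minimal-length element of the coset `w W_J`. -/
noncomputable def projR (J : Set B) (w : W) : W :=
  if h : ∃ a, a ∈ minRight cs J ∧ a⁻¹ * w ∈ parabolic cs J then h.choose else w

/-- `^Jw`: the minimal-length element of the coset `W_J w`. -/
noncomputable def projL (J : Set B) (w : W) : W :=
  if h : ∃ a, a ∈ minLeft cs J ∧ w * a⁻¹ ∈ parabolic cs J then h.choose else w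

theorem end_mul_apply {α : Type*} (f g : Function.End α) (x : α) : (f * g) x = f (g x) := rfl

theorem end_one_apply {α : Type*} (x : α) : (1 : Function.End α) x = x := rfl

/-- The action of the `i`-th simple reflection on `W × ℤ/2`: conjugation on the first factor, with
the second factor recording whether the first one is the reflection itself. -/
noncomputable def signStep (i : B) : Function.End (W × ZMod 2) := fun p =>
  (cs.simple i * p.1 * cs.simple i, p.2 + if p.1 = cs.simple i then 1 else 0)

theorem signStep_mul_pow_apply (i j : B) (n : ℕ) (t : W) (ε : ZMod 2) :
    ((signStep cs i * signStep cs j) ^ n) (t, ε) =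
      ((cs.simple i * cs.simple j) ^ n * t * ((cs.simple i * cs.simple j) ^ n)⁻¹,
        ε + ∑ k ∈ Finset.range (2 * n),
          if t = ((cs.simple i * cs.simple j) ^ k)⁻¹ * cs.simple j then 1 else 0) := by
  set a := cs.simple i with ha
  set b := cs.simple j with hb
  have haa : a⁻¹ = a := cs.inv_simple i
  have hbb : b⁻¹ = b := cs.inv_simple j
  have hcomm (k : ℕ) : b * (a * b) ^ k = ((a * b) ^ k)⁻¹ * b := by
    have h : b * (a * b) * b⁻¹ = (a * b)⁻¹ := by
      rw [mul_inv_rev, haa, hbb, mul_assoc, mul_assoc, cs.simple_mul_simple_self, mul_one]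
    rw [← inv_pow, ← h, conj_pow]
    group
  induction n with
  | zero => simp [end_one_apply]
  | succ n ih =>
    rw [pow_succ', end_mul_apply, ih]
    set c := (a * b) ^ n with hc
    have h₁ : c * t * c⁻¹ = b ↔ t = ((a * b) ^ (2 * n))⁻¹ * b := by
      rw [← hcomm, two_mul, pow_add, ← mul_assoc, hcomm, ← hc]
      constructor
      · intro h
        rw [← h]; group
      · intro h
        rw [h]; group
    have h₂ : b * (c * t * c⁻¹) * b = a ↔ t = ((a * b) ^ (2 * n + 1))⁻¹ * b := by
      have e : ((a * b) ^ (2 * n + 1))⁻¹ * b = c⁻¹ * (b⁻¹ * a * b⁻¹) * c := by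
        rw [← hcomm, show 2 * n + 1 = n + (1 + n) by ring, pow_add, ← mul_assoc, hcomm, pow_add,
          pow_one, ← hc, hbb]
        simp only [mul_assoc]
      rw [e]
      constructor
      · intro h
        rw [← h]; group
      · intro h
        rw [h]; group
    refine Prod.ext ?_ ?_
    · simp only [signStep, end_mul_apply, ← ha, ← hb, pow_succ' _ n,
        mul_inv_rev, haa, hbb, ← hc, mul_assoc]
    · simp only [signStep, end_mul_apply, ← ha, ← hb, h₁]
      rw [if_congr h₂ rfl rfl]
      rw [show 2 * (n + 1) = 2 * n + 1 + 1 by ring, Finset.sum_range_succ, Finset.sum_range_succ]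
      simp only [add_assoc]

theorem isLiftable_signStep : M.IsLiftable (signStep cs) := by
  intro i j
  funext ⟨t, ε⟩
  rw [signStep_mul_pow_apply, two_mul, Finset.sum_range_add]
  simp only [pow_add, cs.simple_mul_simple_pow, one_mul]
  simp [CharTwo.add_self_eq_zero, end_one_apply]

theorem lift_signStep_wordProd (ω : List B) (t : W) (ε : ZMod 2) :
    cs.lift ⟨signStep cs, isLiftable_signStep cs⟩ (cs.wordProd ω) (t, ε) =
      (cs.wordProd ω * t * (cs.wordProd ω)⁻¹, ε + ((cs.rightInvSeq ω).count t : ZMod 2)) := by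
  induction ω with
  | nil => simp [end_one_apply]
  | cons i ω ih =>
    rw [cs.wordProd_cons, map_mul, end_mul_apply, ih,
      cs.lift_apply_simple (isLiftable_signStep cs)]
    have h : cs.wordProd ω * t * (cs.wordProd ω)⁻¹ = cs.simple i ↔
        (cs.wordProd ω)⁻¹ * cs.simple i * cs.wordProd ω = t := by
      constructor
      · intro h
        rw [← h]; group
      · intro h
        rw [← h]; group
    simp only [mul_assoc] at h
    simp [signStep, CoxeterSystem.rightInvSeq, List.count_cons, h, mul_assoc, add_assoc]

/-- The **exchange property**: if `s_i` is a right descent of the product of a word, then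
multiplying by `s_i` on the right amounts to erasing a letter of the word. -/
theorem exists_eraseIdx_of_isRightDescent {ω : List B} {i : B}
    (h : cs.IsRightDescent (cs.wordProd ω) i) :
    ∃ k < ω.length, cs.wordProd ω * cs.simple i = cs.wordProd (ω.eraseIdx k) := by
  obtain ⟨ρ, hρ, hρω⟩ := cs.exists_isReduced (cs.wordProd ω * cs.simple i)
  have hprod : cs.wordProd (ρ.concat i) = cs.wordProd ω := by
    rw [cs.wordProd_concat, ← hρω, cs.simple_mul_simple_cancel_right]
  have hnot : cs.simple i ∉ cs.rightInvSeq ρ := by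
    intro hmem
    have := (cs.isRightInversion_of_mem_rightInvSeq hρ hmem).2
    rw [← hρω, cs.simple_mul_simple_cancel_right] at this
    exact lt_asymm this h
  have hcount : (cs.rightInvSeq (ρ.concat i)).count (cs.simple i) = 1 := by
    have hinj : Function.Injective (MulAut.conj (cs.simple i)) := (MulAut.conj _).injective
    have hfix : MulAut.conj (cs.simple i) (cs.simple i) = cs.simple i := by simp
    have hmap : (List.map (MulAut.conj (cs.simple i)) (cs.rightInvSeq ρ)).count (cs.simple i) =
        (cs.rightInvSeq ρ).count (cs.simple i) := by
      simpa only [hfix] using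
        List.count_map_of_injective (cs.rightInvSeq ρ) _ hinj (cs.simple i)
    rw [cs.rightInvSeq_concat, List.concat_eq_append, List.count_append, hmap,
      List.count_eq_zero.2 hnot]
    simp
  have hpar : (((cs.rightInvSeq ω).count (cs.simple i) : ℕ) : ZMod 2) = 1 := by
    have h₁ := lift_signStep_wordProd cs ω (cs.simple i) 0
    have h₂ := lift_signStep_wordProd cs (ρ.concat i) (cs.simple i) 0
    rw [hprod, h₁, hcount] at h₂
    simpa using congrArg Prod.snd h₂
  have hmem : cs.simple i ∈ cs.rightInvSeq ω := by
    by_contra hmem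
    rw [List.count_eq_zero.2 hmem] at hpar
    simp at hpar
  obtain ⟨k, hk, hki⟩ := List.getElem_of_mem hmem
  refine ⟨k, by simpa using hk, ?_⟩
  rw [← cs.wordProd_mul_getD_rightInvSeq, List.getD_eq_getElem _ _ hk, hki]

theorem parabolic_induction {J : Set B} {p : W → Prop} (one : p 1)
    (mul_simple : ∀ u ∈ parabolic cs J, ∀ i ∈ J, p u → p (u * cs.simple i)) {u : W}
    (hu : u ∈ parabolic cs J) : p u := by
  induction hu using Subgroup.closure_induction_right with
  | one => exact one
  | mul_right x hx y hy ih =>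
    obtain ⟨i, hi, rfl⟩ := hy
    exact mul_simple x hx i hi ih
  | mul_inv_cancel x hx y hy ih =>
    obtain ⟨i, hi, rfl⟩ := hy
    rw [cs.inv_simple]
    exact mul_simple x hx i hi ih

theorem mem_minRight_of_forall_length_le {J : Set B} {w : W}
    (hw : ∀ u ∈ parabolic cs J, cs.length w ≤ cs.length (w * u)) : w ∈ minRight cs J := by
  obtain ⟨ρ, hρ, rfl⟩ := cs.exists_isReduced w
  have key (u : W) (hu : u ∈ parabolic cs J) : ∃ ω : List B, cs.wordProd ω = u ∧
      cs.length (cs.wordProd ρ * u) = cs.length (cs.wordProd ρ) + ω.length := by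
    refine parabolic_induction cs (p := fun u => ∃ ω : List B, cs.wordProd ω = u ∧
      cs.length (cs.wordProd ρ * u) = cs.length (cs.wordProd ρ) + ω.length)
      ⟨[], by simp⟩ (fun u hu i hi ih => ?_) hu
    obtain ⟨ω, rfl, hω⟩ := ih
    rw [← mul_assoc]
    by_cases hd : cs.IsRightDescent (cs.wordProd (ρ ++ ω)) i
    · obtain ⟨k, hk, hkω⟩ := exists_eraseIdx_of_isRightDescent cs hd
      rw [cs.isRightDescent_iff, cs.wordProd_append] at hd
      rw [cs.wordProd_append] at hkω
      rcases lt_or_ge k ρ.length with hkρ | hkρ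
      · exfalso
        rw [List.eraseIdx_append_of_lt_length hkρ, cs.wordProd_append] at hkω
        have hmem : cs.wordProd ω * cs.simple i * (cs.wordProd ω)⁻¹ ∈ parabolic cs J :=
          mul_mem (mul_mem hu (Subgroup.subset_closure ⟨i, hi, rfl⟩)) (inv_mem hu)
        have hle := hw _ hmem
        rw [← mul_assoc, ← mul_assoc, hkω, mul_inv_cancel_right, hρ.eq] at hle
        have := cs.length_wordProd_le (ρ.eraseIdx k)
        have := List.length_eraseIdx_add_one hkρ
        omega
      · rw [List.eraseIdx_append_of_length_le hkρ, cs.wordProd_append, mul_assoc] at hkω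
        refine ⟨ω.eraseIdx (k - ρ.length), (mul_left_cancel hkω).symm, ?_⟩
        rw [List.length_append] at hk
        have := List.length_eraseIdx_add_one (l := ω) (i := k - ρ.length) (by omega)
        omega
    · rw [cs.not_isRightDescent_iff, cs.wordProd_append] at hd
      refine ⟨ω.concat i, cs.wordProd_concat i ω, ?_⟩
      rw [List.length_concat]
      omega
  intro u hu
  obtain ⟨ω, rfl, hω⟩ := key u hu
  have := cs.length_wordProd_le ω
  have := cs.length_mul_le (cs.wordProd ρ) (cs.wordProd ω)
  omega

theorem exists_mul_mem_minRight (J : Set B) (w : W) :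
    ∃ u ∈ parabolic cs J, w * u ∈ minRight cs J := by
  obtain ⟨u, hmin⟩ := exists_minimalFor_of_wellFoundedLT (· ∈ parabolic cs J)
    (fun u => cs.length (w * u)) ⟨1, one_mem _⟩
  refine ⟨u, hmin.1, mem_minRight_of_forall_length_le cs fun v hv => ?_⟩
  rw [mul_assoc]
  exact le_of_not_gt (hmin.not_lt (mul_mem hmin.1 hv))

theorem inv_mem_minLeft {J : Set B} {w : W} (hw : w ∈ minRight cs J) : w⁻¹ ∈ minLeft cs J := by
  intro u hu
  have := hw u⁻¹ (inv_mem hu)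
  rw [← cs.length_inv, mul_inv_rev, inv_inv, this, cs.length_inv, cs.length_inv, add_comm]

theorem exists_mul_mem_minLeft (J : Set B) (w : W) :
    ∃ u ∈ parabolic cs J, u * w ∈ minLeft cs J := by
  obtain ⟨u, hu, h⟩ := exists_mul_mem_minRight cs J w⁻¹
  exact ⟨u⁻¹, inv_mem hu, by simpa using inv_mem_minLeft cs h⟩

theorem eq_one_of_mul_mem_minRight {J : Set B} {w u : W} (hu : u ∈ parabolic cs J)
    (hw : w ∈ minRight cs J) (hwu : w * u ∈ minRight cs J) : u = 1 := by
  have h₁ := hw u hu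
  have h₂ := hwu u⁻¹ (inv_mem hu)
  rw [mul_inv_cancel_right] at h₂
  exact cs.length_eq_zero_iff.1 (by omega)

theorem eq_one_of_mul_mem_minLeft {J : Set B} {w u : W} (hu : u ∈ parabolic cs J)
    (hw : w ∈ minLeft cs J) (huw : u * w ∈ minLeft cs J) : u = 1 := by
  have h₁ := hw u hu
  have h₂ := huw u⁻¹ (inv_mem hu)
  rw [inv_mul_cancel_left] at h₂
  exact cs.length_eq_zero_iff.1 (by omega)

theorem parabolic_mono {J K : Set B} (h : J ⊆ K) : parabolic cs J ≤ parabolic cs K :=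
  Subgroup.closure_mono (Set.image_mono h)

theorem commute_of_mem_parabolic_perp {Θ : Set B} {a b : W} (ha : a ∈ parabolic cs Θ)
    (hb : b ∈ parabolic cs (perp M Θ)) : Commute a b := by
  have hgen {i j : B} (hi : i ∈ perp M Θ) (hj : j ∈ Θ) :
      Commute (cs.simple j) (cs.simple i) := by
    have h := cs.simple_mul_simple_pow i j
    rw [hi.2 j hj, pow_two, mul_eq_one_iff_eq_inv, mul_inv_rev, cs.inv_simple,
      cs.inv_simple] at h
    exact h.symm
  have hle : parabolic cs Θ ≤ Subgroup.centralizer (parabolic cs (perp M Θ) : Set W) := by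
    rw [parabolic, parabolic, Subgroup.centralizer_closure, Subgroup.closure_le]
    rintro _ ⟨j, hj, rfl⟩
    rw [SetLike.mem_coe, Subgroup.mem_centralizer_iff]
    rintro _ ⟨i, hi, rfl⟩
    exact (hgen hi hj).symm
  exact (Subgroup.mem_centralizer_iff.1 (hle ha) b hb).symm

theorem exists_mul_eq_of_mem_parabolic_union_perp {Θ : Set B} {u : W}
    (hu : u ∈ parabolic cs (Θ ∪ perp M Θ)) :
    ∃ a ∈ parabolic cs Θ, ∃ b ∈ parabolic cs (perp M Θ), a * b = u := by
  refine parabolic_induction cs (p := fun u => ∃ a ∈ parabolic cs Θ,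
    ∃ b ∈ parabolic cs (perp M Θ), a * b = u) ⟨1, one_mem _, 1, one_mem _, one_mul 1⟩ ?_ hu
  rintro _ - i hi ⟨a, ha, b, hb, rfl⟩
  rcases hi with hi | hi
  · have hs : cs.simple i ∈ parabolic cs Θ := Subgroup.subset_closure ⟨i, hi, rfl⟩
    refine ⟨a * cs.simple i, mul_mem ha hs, b, hb, ?_⟩
    rw [mul_assoc, mul_assoc, (commute_of_mem_parabolic_perp cs hs hb).eq]
  · exact ⟨a, ha, b * cs.simple i, mul_mem hb (Subgroup.subset_closure ⟨i, hi, rfl⟩),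
      (mul_assoc _ _ _).symm⟩

/-- every `∼_Θ`-class contains exactly one pair `(w₁, w₂)` with
`w₁ ∈ W^Θ` and `w₂ ∈ ^{Θ∪Θ^⊥}W` (normal form I). -/
theorem statement2 [Finite B] (Θ : Set B) (p : W × W) :
    ∃! q : W × W, simRel cs Θ p q ∧
      q.1 ∈ minRight cs Θ ∧ q.2 ∈ minLeft cs (Θ ∪ perp M Θ) := by
  obtain ⟨x, y⟩ := p
  have hΘ : parabolic cs Θ ≤ parabolic cs (Θ ∪ perp M Θ) :=
    parabolic_mono cs Set.subset_union_left
  have hperp : parabolic cs (perp M Θ) ≤ parabolic cs (Θ ∪ perp M Θ) :=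
    parabolic_mono cs Set.subset_union_right
  obtain ⟨g, hg, hgy⟩ := exists_mul_mem_minLeft cs (Θ ∪ perp M Θ) y
  obtain ⟨a, ha, b, hb, rfl⟩ := exists_mul_eq_of_mem_parabolic_union_perp cs hg
  obtain ⟨c, hc, hxc⟩ := exists_mul_mem_minRight cs Θ (x * b⁻¹)
  refine ⟨(x * b⁻¹ * c, a * b * y), ⟨⟨b⁻¹ * c, mul_mem (inv_mem (hperp hb)) (hΘ hc),
    c * a, mul_mem hc ha, (mul_assoc _ _ _), ?_⟩, hxc, hgy⟩, ?_⟩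
  · have hab := (commute_of_mem_parabolic_perp cs ha hb).eq
    simp only [mul_inv_rev, inv_inv]
    rw [hab, commute_of_mem_parabolic_perp cs (inv_mem hc) hb |>.eq]
    group
  · rintro ⟨x', y'⟩ ⟨⟨u, hu, v, hv, rfl, rfl⟩, hx', hy'⟩
    dsimp only at hx' hy' ⊢
    have hmem : u⁻¹ * v * (a * b)⁻¹ ∈ parabolic cs (Θ ∪ perp M Θ) :=
      mul_mem (mul_mem (inv_mem hu) (hΘ hv)) (inv_mem hg)
    have h₁ : u⁻¹ * v = a * b := by
      refine mul_inv_eq_one.1 (eq_one_of_mul_mem_minLeft cs hmem hgy ?_)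
      rwa [mul_assoc, inv_mul_cancel_left]
    have hxu : x * u = x * b⁻¹ * c * (c⁻¹ * (v * a⁻¹)) := by
      rw [← mul_assoc, mul_inv_cancel_right, mul_assoc, ← mul_assoc b⁻¹,
        ← (commute_of_mem_parabolic_perp cs hv (inv_mem hb)).eq, mul_assoc v, ← mul_inv_rev, ← h₁]
      group
    have h₂ : c⁻¹ * (v * a⁻¹) = 1 :=
      eq_one_of_mul_mem_minRight cs (mul_mem (inv_mem hc) (mul_mem hv (inv_mem ha))) hxc
        (hxu ▸ hx')
    rw [hxu, h₁, h₂, mul_one]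

end Paper
end

section
/- Let Θ' ⊆ Θ ⊆ I, and let w₁ ∈ W^Θ, w₂ ∈ ^{Θ∪Θ^⊥}W, w₁' ∈ W^{Θ'}, w₂' ∈ ^{Θ'∪Θ'^⊥}W. Then the following are equivalent: (ii) there exists w ∈ W_{Θ'^⊥} such that w₁ ≤ (w₁'w)^Θ and w₂ ≥ ^Θ(w⁻¹w₂') in the Bruhat order; (iii) there exists w ∈ W_{Θ'^⊥}·W_Θ (a product of an element of W_{Θ'^⊥} and an element of W_Θ) such that w₁ ≤ w₁'w and w₂ ≥ w⁻¹w₂' in the Bruhat order. -/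
open Classical

namespace Paper

variable {B : Type*} {M : CoxeterMatrix B} {W : Type*} [Group W]

variable (cs : CoxeterSystem M W)

section StrongExchange

/-- The permutation `(t, ε) ↦ (s t s, ε + [t = s])` of `W × ZMod 2`, for `s` an involution. -/
noncomputable def signedConj (s : W) (hs : s * s = 1) : Equiv.Perm (W × ZMod 2) :=
  Function.Involutive.toPerm (fun p => (s * p.1 * s, p.2 + if p.1 = s then 1 else 0)) <| by
    rintro ⟨t, ε⟩
    have h : s * (s * t * s) * s = t := by
      rw [show s * (s * t * s) * s = (s * s) * t * (s * s) by group, hs, one_mul, mul_one]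
    have h' : s * t * s = s ↔ t = s := by
      constructor
      · intro e
        rw [e, mul_assoc, hs, mul_one] at h
        exact h.symm
      · rintro rfl
        rw [hs, one_mul]
    ext
    · exact h
    · simp only [h', add_assoc, CharTwo.add_self_eq_zero, add_zero]

theorem signedConj_apply (s : W) (hs : s * s = 1) (p : W × ZMod 2) :
    signedConj s hs p = (s * p.1 * s, p.2 + if p.1 = s then 1 else 0) := rfl

theorem signedConj_mul_pow_apply (a b : W) (ha : a * a = 1) (hb : b * b = 1) (n : ℕ)
    (t : W) (ε : ZMod 2) :
    ((signedConj a ha * signedConj b hb) ^ n) (t, ε) =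
      ((a * b) ^ n * t * ((a * b) ^ n)⁻¹,
        ε + ∑ r ∈ Finset.range (2 * n), if t = ((a * b) ^ r)⁻¹ * b then 1 else 0) := by
  have ha' : a⁻¹ = a := inv_eq_of_mul_eq_one_left ha
  have hb' : b⁻¹ = b := inv_eq_of_mul_eq_one_left hb
  have key : ∀ k : ℕ, b * (a * b) ^ k * b = ((a * b) ^ k)⁻¹ := by
    intro k
    have := (conj_pow (i := k) (a := b) (b := a * b)).symm
    rw [hb'] at this
    rw [this, ← inv_pow, mul_inv_rev, ha', hb', mul_assoc, mul_assoc, hb, mul_one]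
  have key2 : ∀ k : ℕ, ((a * b) ^ k)⁻¹ * b * (a * b) ^ k = ((a * b) ^ (2 * k))⁻¹ * b := by
    intro k
    have h := key k
    have : b * (a * b) ^ k = ((a * b) ^ k)⁻¹ * b := by
      rw [← h, mul_assoc _ b b, hb, mul_one]
    rw [mul_assoc, this, two_mul, pow_add, mul_inv_rev, mul_assoc]
  induction n with
  | zero => simp
  | succ n ih =>
    rw [pow_succ', Equiv.Perm.mul_apply, ih, Equiv.Perm.mul_apply, signedConj_apply,
      signedConj_apply, mul_add, mul_one, Finset.sum_range_succ, Finset.sum_range_succ]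
    have conj_eq_iff (g y : W) : g * t * g⁻¹ = y ↔ t = g⁻¹ * y * g := by
      rw [mul_inv_eq_iff_eq_mul, ← eq_inv_mul_iff_mul_eq, mul_assoc]
    have e1 : (a * b) ^ n * t * ((a * b) ^ n)⁻¹ = b ↔ t = ((a * b) ^ (2 * n))⁻¹ * b := by
      rw [conj_eq_iff, key2]
    have e2 : b * ((a * b) ^ n * t * ((a * b) ^ n)⁻¹) * b = a ↔
        t = ((a * b) ^ (2 * n + 1))⁻¹ * b := by
      have h : ((a * b) ^ n)⁻¹ * (b * a * b) * (a * b) ^ n = ((a * b) ^ (2 * n + 1))⁻¹ * b :=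
        calc
          _ = ((a * b) ^ n)⁻¹ * (a * b)⁻¹ * b * (a * b) ^ n := by
            rw [mul_inv_rev a b, ha', hb']
            simp only [mul_assoc]
          _ = (a * b)⁻¹ * (((a * b) ^ n)⁻¹ * b * (a * b) ^ n) := by
            rw [← mul_inv_rev, ← pow_succ', pow_succ, mul_inv_rev]
            simp only [mul_assoc]
          _ = _ := by
            rw [key2, ← mul_assoc, ← mul_inv_rev, ← pow_succ]
      rw [← h, ← conj_eq_iff, ← eq_mul_inv_iff_mul_eq, ← eq_inv_mul_iff_mul_eq, hb', mul_assoc b a]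
    ext
    · simp only
      rw [pow_succ', mul_inv_rev, mul_inv_rev, ha', hb']
      group
    · simp only [e1, e2, add_assoc]

theorem signedConj_isLiftable :
    M.IsLiftable fun i => signedConj (cs.simple i) (cs.simple_mul_simple_self i) := by
  intro i j
  ext1 ⟨t, ε⟩
  rw [signedConj_mul_pow_apply, two_mul, Finset.sum_range_add]
  simp only [pow_add, cs.simple_mul_simple_pow, one_mul, inv_one, mul_one,
    CharTwo.add_self_eq_zero, add_zero, Equiv.Perm.coe_one, id_eq]

/-- The action of `W` on `W × ZMod 2` in which the second coordinate counts
the inversions equal to the first. -/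
noncomputable def inversionAction : W →* Equiv.Perm (W × ZMod 2) :=
  cs.lift ⟨_, signedConj_isLiftable cs⟩

theorem inversionAction_wordProd (ω : List B) (t : W) (ε : ZMod 2) :
    inversionAction cs (cs.wordProd ω) (t, ε) =
      (cs.wordProd ω * t * (cs.wordProd ω)⁻¹, ε + (cs.rightInvSeq ω).count t) := by
  induction ω with
  | nil => simp
  | cons i ω ih =>
    have h : inversionAction cs (cs.simple i) =
        signedConj (cs.simple i) (cs.simple_mul_simple_self i) := by
      rw [inversionAction, cs.lift_apply_simple]
    have e : cs.wordProd ω * t * (cs.wordProd ω)⁻¹ = cs.simple i ↔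
        (cs.wordProd ω)⁻¹ * cs.simple i * cs.wordProd ω = t := by
      constructor
      · intro h; rw [← h]; group
      · rintro rfl; group
    rw [cs.wordProd_cons, map_mul, Equiv.Perm.mul_apply, ih, h, signedConj_apply,
      CoxeterSystem.rightInvSeq, List.count_cons]
    ext
    · simp [mul_assoc]
    · simp only [e, beq_iff_eq, Nat.cast_add, Nat.cast_ite, Nat.cast_one, Nat.cast_zero,
        add_assoc]

theorem inversionAction_apply (w t : W) (ε : ZMod 2) :
    inversionAction cs w (t, ε) = (w * t * w⁻¹, ε + (inversionAction cs w (t, 0)).2) := by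
  obtain ⟨ω, rfl⟩ := cs.wordProd_surjective w
  simp [inversionAction_wordProd]

theorem inversionAction_mul_snd (v w t : W) :
    (inversionAction cs (v * w) (t, 0)).2 =
      (inversionAction cs w (t, 0)).2 + (inversionAction cs v (w * t * w⁻¹, 0)).2 := by
  rw [map_mul, Equiv.Perm.mul_apply, inversionAction_apply cs w, inversionAction_apply cs v]

theorem inversionAction_self {t : W} (ht : cs.IsReflection t) :
    (inversionAction cs t (t, 0)).2 = 1 := by
  obtain ⟨w, i, rfl⟩ := ht
  have h1 : (inversionAction cs (cs.simple i) (cs.simple i, 0)).2 = 1 := by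
    have := inversionAction_wordProd cs [i] (cs.simple i) 0
    simp only [cs.wordProd_singleton] at this
    simp [this]
  have h2 := inversionAction_mul_snd cs w w⁻¹ (w * cs.simple i * w⁻¹)
  rw [mul_inv_cancel, map_one, Equiv.Perm.one_apply] at h2
  have e : w⁻¹ * (w * cs.simple i * w⁻¹) * w⁻¹⁻¹ = cs.simple i := by group
  rw [e] at h2
  rw [inversionAction_mul_snd, e, inversionAction_mul_snd, h1, mul_inv_cancel_right,
    add_left_comm, ← h2, add_zero]

theorem length_mul_lt_of_inversionAction {w t : W}
    (h : (inversionAction cs w (t, 0)).2 ≠ 0) : cs.length (w * t) < cs.length w := by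
  obtain ⟨ω, hω, rfl⟩ := cs.exists_isReduced w
  rw [inversionAction_wordProd] at h
  have : t ∈ cs.rightInvSeq ω := by
    by_contra hn
    simp [List.count_eq_zero_of_not_mem hn] at h
  exact (cs.isRightInversion_of_mem_rightInvSeq hω this).2

/-- The strong exchange property. -/
theorem mem_rightInvSeq_of_length_lt {ω : List B} {t : W} (ht : cs.IsReflection t)
    (h : cs.length (cs.wordProd ω * t) < cs.length (cs.wordProd ω)) :
    t ∈ cs.rightInvSeq ω := by
  by_contra hn
  have h0 : (inversionAction cs (cs.wordProd ω) (t, 0)).2 = 0 := by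
    simp [inversionAction_wordProd, List.count_eq_zero_of_not_mem hn]
  have h1 : (inversionAction cs (cs.wordProd ω * t) (t, 0)).2 ≠ 0 := by
    rw [inversionAction_mul_snd, mul_inv_cancel_right, h0, inversionAction_self cs ht]
    decide
  have := length_mul_lt_of_inversionAction cs h1
  rw [mul_assoc, ht.mul_self, mul_one] at this
  omega

theorem exists_wordProd_eraseIdx {ω : List B} {t : W} (ht : cs.IsReflection t)
    (h : cs.length (cs.wordProd ω * t) < cs.length (cs.wordProd ω)) :
    ∃ j < ω.length, cs.wordProd ω * t = cs.wordProd (ω.eraseIdx j) := by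
  obtain ⟨j, hj, rfl⟩ := List.mem_iff_getElem.1 (mem_rightInvSeq_of_length_lt cs ht h)
  refine ⟨j, by simpa using hj, ?_⟩
  rw [← cs.wordProd_mul_getD_rightInvSeq, List.getD_eq_getElem _ _ hj]

end StrongExchange

section Bruhat

variable {cs}

theorem bruhatLE.trans {x y z : W} (h : bruhatLE cs x y) (h' : bruhatLE cs y z) :
    bruhatLE cs x z :=
  Relation.ReflTransGen.trans h h'

theorem bruhatLE_mul_of_length_lt {x t : W} (ht : cs.IsReflection t)
    (h : cs.length x < cs.length (x * t)) : bruhatLE cs x (x * t) :=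
  Relation.ReflTransGen.single ⟨t, ht, rfl, h⟩

theorem bruhatLE.inv {x y : W} (h : bruhatLE cs x y) : bruhatLE cs x⁻¹ y⁻¹ := by
  refine Relation.ReflTransGen.lift (·⁻¹) ?_ x y h
  rintro a _ ⟨t, ht, rfl, hl⟩
  refine ⟨a * t * a⁻¹, ht.conj a, ?_, by simpa only [cs.length_inv] using hl⟩
  simp [mul_assoc, ht.inv]

theorem length_mul_simple_lt_of_length_lt {x t : W} (ht : cs.IsReflection t)
    (h : cs.length x < cs.length (x * t)) (i : B) (hti : t ≠ cs.simple i) :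
    cs.length (x * cs.simple i) < cs.length (x * t * cs.simple i) := by
  by_contra hn
  have hr : cs.IsReflection (cs.simple i * t * cs.simple i) := by
    simpa using ht.conj (cs.simple i)
  have hmul : x * cs.simple i * (cs.simple i * t * cs.simple i) = x * t * cs.simple i := by
    simp [mul_assoc]
  have hne : cs.length (x * t * cs.simple i) ≠ cs.length (x * cs.simple i) := by
    rw [← hmul]
    exact hr.length_mul_left_ne _
  have hxi := cs.length_mul_simple x i
  have hti' := cs.length_mul_simple (x * t) i
  obtain ⟨ω, hω, rfl⟩ := cs.exists_isReduced x
  have hc : cs.wordProd (ω ++ [i]) = cs.wordProd ω * cs.simple i := by simp [cs.wordProd_append]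
  obtain ⟨j, hj, he⟩ := exists_wordProd_eraseIdx cs (ω := ω ++ [i]) hr (by
    rw [hc, hmul]; omega)
  rw [hc, hmul] at he
  by_cases hjl : j < ω.length
  · rw [List.eraseIdx_append_of_lt_length hjl, cs.wordProd_append, cs.wordProd_singleton,
      mul_left_inj] at he
    have hle := cs.length_wordProd_le (ω.eraseIdx j)
    rw [← he, List.length_eraseIdx_of_lt hjl] at hle
    have := hω.eq
    omega
  · obtain rfl : j = ω.length := by simp at hj; omega
    rw [List.eraseIdx_append_of_length_le le_rfl] at he
    simp only [Nat.sub_self, List.eraseIdx_cons_zero, List.append_nil, mul_assoc,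
      mul_eq_left] at he
    exact hti (by rw [eq_inv_of_mul_eq_one_left he, cs.inv_simple])

/-- A form of the lifting property of the Bruhat order. -/
theorem bruhatLE.mul_simple {x y : W} (h : bruhatLE cs x y) (i : B)
    (hx : cs.length x < cs.length (x * cs.simple i)) : bruhatLE cs x (y * cs.simple i) := by
  suffices bruhatLE cs x (y * cs.simple i) ∨
      bruhatLE cs (x * cs.simple i) (y * cs.simple i) from
    this.elim id fun h' => (bruhatLE_mul_of_length_lt (cs.isReflection_simple i) hx).trans h'
  induction h with
  | refl => exact Or.inr .refl
  | @tail y z hxy hyz ih =>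
    obtain ⟨t, ht, rfl, hl⟩ := hyz
    by_cases hti : t = cs.simple i
    · left
      rw [hti, cs.simple_mul_simple_cancel_right]
      exact hxy
    · have hs : bruhatLE cs (y * cs.simple i) (y * t * cs.simple i) := by
        have hr : cs.IsReflection (cs.simple i * t * cs.simple i) := by
          simpa using ht.conj (cs.simple i)
        refine Relation.ReflTransGen.single ⟨_, hr, by simp [mul_assoc], ?_⟩
        exact length_mul_simple_lt_of_length_lt ht hl i hti
      exact ih.imp (·.trans hs) (·.trans hs)

end Bruhat

section Parabolic

variable {cs}

theorem wordProd_mem_parabolic {J : Set B} {ω : List B} (h : ∀ i ∈ ω, i ∈ J) :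
    cs.wordProd ω ∈ parabolic cs J := by
  refine Subgroup.list_prod_mem _ fun x hx => ?_
  obtain ⟨i, hi, rfl⟩ := List.mem_map.1 hx
  exact Subgroup.subset_closure ⟨i, h i hi, rfl⟩

theorem exists_wordProd_eq_of_mem_parabolic {J : Set B} {u : W} (hu : u ∈ parabolic cs J) :
    ∃ ω : List B, (∀ i ∈ ω, i ∈ J) ∧ cs.wordProd ω = u := by
  induction hu using Subgroup.closure_induction with
  | mem x hx =>
    obtain ⟨i, hi, rfl⟩ := hx
    exact ⟨[i], by simpa using hi, cs.wordProd_singleton i⟩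
  | one => exact ⟨[], by simp, cs.wordProd_nil⟩
  | mul x y _ _ hx hy =>
    obtain ⟨ω, hω, rfl⟩ := hx
    obtain ⟨ω', hω', rfl⟩ := hy
    exact ⟨ω ++ ω', by simpa [or_imp, forall_and] using ⟨hω, hω'⟩, cs.wordProd_append ω ω'⟩
  | inv x _ hx =>
    obtain ⟨ω, hω, rfl⟩ := hx
    exact ⟨ω.reverse, by simpa using hω, cs.wordProd_reverse ω⟩

theorem bruhatLE.mul_of_mem_parabolic {J : Set B} {x y u : W} (hx : x ∈ minRight cs J)
    (h : bruhatLE cs x y) (hu : u ∈ parabolic cs J) : bruhatLE cs x (y * u) := by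
  obtain ⟨ω, hω, rfl⟩ := exists_wordProd_eq_of_mem_parabolic hu
  clear hu
  induction ω generalizing y with
  | nil => simpa using h
  | cons i ω ih =>
    rw [cs.wordProd_cons, ← mul_assoc]
    refine ih (h.mul_simple i ?_) fun j hj => hω j (List.mem_cons_of_mem _ hj)
    rw [hx _ (Subgroup.subset_closure ⟨i, hω i List.mem_cons_self, rfl⟩), cs.length_simple]
    omega

/-- If `a` is shortest in `a W_J`, then lengths add along a word in `J` of minimal length. -/
theorem length_mul_wordProd {J : Set B} {a : W}
    (ha : ∀ u ∈ parabolic cs J, cs.length a ≤ cs.length (a * u)) (ω : List B)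
    (hω : ∀ i ∈ ω, i ∈ J)
    (hmin : ∀ ω' : List B, (∀ i ∈ ω', i ∈ J) → cs.wordProd ω' = cs.wordProd ω →
      ω.length ≤ ω'.length) :
    cs.length (a * cs.wordProd ω) = cs.length a + ω.length := by
  induction ω using List.reverseRecOn with
  | nil => simp
  | append_singleton ω j ih =>
    have hω₀ : ∀ i ∈ ω, i ∈ J := fun i hi => hω i (by simp [hi])
    have hj : j ∈ J := hω j (by simp)
    have ih := ih hω₀ fun ω' h₁ h₂ => by
      have := hmin (ω' ++ [j]) (by simpa [or_imp, forall_and] using ⟨h₁, hj⟩)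
        (by simp [cs.wordProd_append, h₂])
      simpa using this
    rw [cs.wordProd_append, cs.wordProd_singleton, ← mul_assoc, List.length_append,
      List.length_singleton, ← add_assoc, ← ih]
    refine (cs.length_mul_simple _ j).resolve_right fun hlt => ?_
    obtain ⟨α, hα, rfl⟩ := cs.exists_isReduced a
    rw [← cs.wordProd_append] at hlt
    obtain ⟨k, hk, he⟩ := exists_wordProd_eraseIdx cs (ω := α ++ ω)
      (cs.isReflection_simple j) (by omega)
    by_cases hkα : k < α.length
    · rw [List.eraseIdx_append_of_lt_length hkα, cs.wordProd_append, cs.wordProd_append] at he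
      have hle := cs.length_wordProd_le (α.eraseIdx k)
      have hmem : cs.wordProd ω * cs.simple j * (cs.wordProd ω)⁻¹ ∈ parabolic cs J :=
        mul_mem (mul_mem (wordProd_mem_parabolic hω₀) (Subgroup.subset_closure ⟨j, hj, rfl⟩))
          (inv_mem (wordProd_mem_parabolic hω₀))
      have := ha _ hmem
      rw [← mul_assoc, ← mul_assoc, he, mul_inv_cancel_right] at this
      rw [List.length_eraseIdx_of_lt hkα] at hle
      have := hα.eq
      omega
    · have hkα : α.length ≤ k := not_lt.1 hkα
      rw [List.eraseIdx_append_of_length_le hkα, cs.wordProd_append, cs.wordProd_append,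
        mul_assoc, mul_right_inj] at he
      have hkω : k - α.length < ω.length := by
        rw [List.length_append] at hk; omega
      have := hmin (ω.eraseIdx (k - α.length))
        (fun i hi => hω₀ i (List.mem_of_mem_eraseIdx hi))
        (by rw [← he, cs.wordProd_append, cs.wordProd_singleton])
      rw [List.length_eraseIdx_of_lt hkω, List.length_append, List.length_singleton] at this
      omega

theorem mem_minRight_of_length_le {J : Set B} {a : W}
    (ha : ∀ u ∈ parabolic cs J, cs.length a ≤ cs.length (a * u)) : a ∈ minRight cs J := by
  intro u hu
  have hex : ∃ n, ∃ ω : List B, (∀ i ∈ ω, i ∈ J) ∧ cs.wordProd ω = u ∧ ω.length = n := by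
    obtain ⟨ω, hω, he⟩ := exists_wordProd_eq_of_mem_parabolic hu
    exact ⟨_, ω, hω, he, rfl⟩
  obtain ⟨ω, hω, rfl, hlen⟩ := Nat.find_spec hex
  have hmin : ∀ ω' : List B, (∀ i ∈ ω', i ∈ J) → cs.wordProd ω' = cs.wordProd ω →
      ω.length ≤ ω'.length := fun ω' h₁ h₂ => by
    rw [hlen]
    exact Nat.find_min' hex ⟨ω', h₁, h₂, rfl⟩
  have h1 := length_mul_wordProd (cs := cs) (a := 1) (J := J) (by simp) ω hω hmin
  rw [one_mul, cs.length_one, zero_add] at h1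
  rw [length_mul_wordProd ha ω hω hmin, h1]

theorem inv_mem_minRight_iff {J : Set B} {w : W} : w⁻¹ ∈ minRight cs J ↔ w ∈ minLeft cs J := by
  have h (u : W) : cs.length (w⁻¹ * u⁻¹) = cs.length w⁻¹ + cs.length u⁻¹ ↔
      cs.length (u * w) = cs.length u + cs.length w := by
    rw [← mul_inv_rev, cs.length_inv, cs.length_inv, cs.length_inv, add_comm]
  refine ⟨fun hw u hu => (h u).1 (hw _ (inv_mem hu)), fun hw u hu => ?_⟩
  simpa using (h u⁻¹).2 (hw _ (inv_mem hu))

variable (cs)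

theorem exists_mem_minRight (J : Set B) (w : W) :
    ∃ a, a ∈ minRight cs J ∧ a⁻¹ * w ∈ parabolic cs J := by
  let f : parabolic cs J → ℕ := fun u => cs.length (w * u)
  let m := Function.argmin f
  refine ⟨w * m, mem_minRight_of_length_le fun u hu => ?_, ?_⟩
  · rw [mul_assoc]
    exact Function.argmin_le f (m * ⟨u, hu⟩)
  · rw [mul_inv_rev, inv_mul_cancel_right]
    exact inv_mem m.2

theorem exists_mem_minLeft (J : Set B) (w : W) :
    ∃ a, a ∈ minLeft cs J ∧ w * a⁻¹ ∈ parabolic cs J := by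
  obtain ⟨a, ha, haw⟩ := exists_mem_minRight cs J w⁻¹
  refine ⟨a⁻¹, inv_mem_minRight_iff.1 (by rwa [inv_inv]), ?_⟩
  simpa using inv_mem haw

theorem inv_projR_mul_mem (J : Set B) (w : W) : (projR cs J w)⁻¹ * w ∈ parabolic cs J := by
  rw [projR, dif_pos (exists_mem_minRight cs J w)]
  exact (exists_mem_minRight cs J w).choose_spec.2

theorem mul_inv_projL_mem (J : Set B) (w : W) : w * (projL cs J w)⁻¹ ∈ parabolic cs J := by
  rw [projL, dif_pos (exists_mem_minLeft cs J w)]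
  exact (exists_mem_minLeft cs J w).choose_spec.2

theorem projL_mem_minLeft (J : Set B) (w : W) : projL cs J w ∈ minLeft cs J := by
  rw [projL, dif_pos (exists_mem_minLeft cs J w)]
  exact (exists_mem_minLeft cs J w).choose_spec.1

variable {cs}

theorem projL_bruhatLE_mul {J : Set B} (w : W) {u : W} (hu : u ∈ parabolic cs J) :
    bruhatLE cs (projL cs J w) (u * w) := by
  have h := bruhatLE.mul_of_mem_parabolic (inv_mem_minRight_iff.2 (projL_mem_minLeft cs J w))
    .refl (inv_mem (mul_mem hu (mul_inv_projL_mem cs J w)))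
  simpa [mul_assoc] using h.inv

end Parabolic

/-- equivalence of the two descriptions (ii) and (iii) of the
extended Bruhat order `≤₊₊` for elements in normal form I. -/
theorem statement5 [Finite B] (Θ Θ' : Set B) (hsub : Θ' ⊆ Θ)
    (w₁ w₂ w₁' w₂' : W)
    (h₁ : w₁ ∈ minRight cs Θ) (h₂ : w₂ ∈ minLeft cs (Θ ∪ perp M Θ))
    (h₁' : w₁' ∈ minRight cs Θ') (h₂' : w₂' ∈ minLeft cs (Θ' ∪ perp M Θ')) :
    (∃ w ∈ parabolic cs (perp M Θ'),
        bruhatLE cs w₁ (projR cs Θ (w₁' * w)) ∧ bruhatLE cs (projL cs Θ (w⁻¹ * w₂')) w₂) ↔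
    (∃ a ∈ parabolic cs (perp M Θ'), ∃ b ∈ parabolic cs Θ,
        bruhatLE cs w₁ (w₁' * (a * b)) ∧ bruhatLE cs ((a * b)⁻¹ * w₂') w₂) := by
  have hb : ∀ x y c : W, x⁻¹ * y ∈ parabolic cs Θ → c ∈ parabolic cs Θ →
      x⁻¹ * (y * c) ∈ parabolic cs Θ := fun x y c h hc => by
    rw [← mul_assoc]
    exact mul_mem h hc
  constructor
  · rintro ⟨a, ha, hR, hL⟩
    have hmem := mul_inv_projL_mem cs Θ (a⁻¹ * w₂')
    refine ⟨a, ha, _, hmem, ?_, ?_⟩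
    · have := hR.mul_of_mem_parabolic h₁ (hb _ _ _ (inv_projR_mul_mem cs Θ (w₁' * a)) hmem)
      rwa [mul_inv_cancel_left, mul_assoc] at this
    · simpa [mul_assoc] using hL
  · rintro ⟨a, ha, b, hbΘ, hR, hL⟩
    refine ⟨a, ha, ?_, ?_⟩
    · have := hR.mul_of_mem_parabolic h₁
        (inv_mem (hb _ _ _ (inv_projR_mul_mem cs Θ (w₁' * a)) hbΘ))
      simpa [mul_assoc] using this
    · refine (projL_bruhatLE_mul _ (inv_mem hbΘ)).trans ?_
      rwa [← mul_assoc, ← mul_inv_rev]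

end Paper
end
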